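/- (Moser-type commutator estimate) There is a constant C depending only on N and k such that for all f ∈ H^k(𝕋^N) with Df ∈ L^∞ and g ∈ H^{k-1}(𝕋^N) ∩ L^∞, and every multi-index α with |α| ≤ k, ‖D^α(fg) − f D^α g‖_{L²} ≤ C (‖Df‖_{L^∞} ‖D^{k−1} g‖_{L²} + ‖g‖_{L^∞} ‖D^k f‖_{L²}). -/

import Mathlib

noncomputable section
open MeasureTheory Set
open scoped ENNReal NNReal

/-- Partial derivative operator in direction `j`. -/
def pd {N : ℕ} (j : Fin N) (f : (Fin N → ℝ) → ℝ) : (Fin N → ℝ) → ℝ :=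
  fun x => fderiv ℝ f x (Pi.single j 1)

/-- Iterated partial derivative `D^α` for a multi-index `α`. -/
def Dalpha {N : ℕ} (α : Fin N → ℕ) (f : (Fin N → ℝ) → ℝ) : (Fin N → ℝ) → ℝ :=
  ((List.ofFn fun j : Fin N => (pd j)^[α j]).foldr (· ∘ ·) id) f

/-- Fundamental domain of the torus `𝕋^N`. -/
def unitBox (N : ℕ) : Set (Fin N → ℝ) := Set.univ.pi fun _ => Set.Ico (0:ℝ) 1

/-- Lebesgue measure on the fundamental domain of the torus. -/
abbrev boxMeasure (N : ℕ) : Measure (Fin N → ℝ) := volume.restrict (unitBox N)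

/-- Smooth functions on the torus, seen as `1`-periodic functions on `ℝ^N`. -/
structure TorusSmooth {N : ℕ} (f : (Fin N → ℝ) → ℝ) : Prop where
  contDiff : ContDiff ℝ (⊤ : ℕ∞) f
  periodic : ∀ x j, f (x + Pi.single j 1) = f x

section Calculus

variable {N : ℕ} {f g : (Fin N → ℝ) → ℝ}

lemma pd_mul (j : Fin N) (hf : Differentiable ℝ f) (hg : Differentiable ℝ g) :
    pd j (f * g) = pd j f * g + f * pd j g := by
  funext x
  simp only [pd, fderiv_mul (hf x) (hg x), Pi.add_apply, Pi.mul_apply, add_apply,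
    smul_apply, smul_eq_mul]
  ring

lemma pd_add (j : Fin N) (hf : Differentiable ℝ f) (hg : Differentiable ℝ g) :
    pd j (f + g) = pd j f + pd j g := by
  funext x
  simp [pd, fderiv_add (hf x) (hg x)]

lemma pd_comp (j : Fin N) {φ φ' : ℝ → ℝ} (hφ : ∀ t, HasDerivAt φ (φ' t) t)
    (hf : Differentiable ℝ f) :
    pd j (fun x => φ (f x)) = fun x => φ' (f x) * pd j f x := by
  funext x
  have := (hφ (f x)).comp_hasFDerivAt x (hf x).hasFDerivAt
  simp only [pd]
  rw [show (fun x => φ (f x)) = φ ∘ f from rfl, this.fderiv]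
  simp

lemma continuous_pd (j : Fin N) (hf : ContDiff ℝ 1 f) : Continuous (pd j f) :=
  (hf.continuous_fderiv one_ne_zero).clm_apply continuous_const

lemma ContDiff.pd (j : Fin N) (hf : ContDiff ℝ (⊤ : ℕ∞) f) : ContDiff ℝ (⊤ : ℕ∞) (pd j f) :=
  (hf.fderiv_right (m := (⊤ : ℕ∞)) (by simp)).clm_apply contDiff_const

lemma pd_comm (i j : Fin N) (hf : ContDiff ℝ (⊤ : ℕ∞) f) : pd i (pd j f) = pd j (pd i f) := by
  have hd : Differentiable ℝ (fderiv ℝ f) :=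
    (hf.fderiv_right (m := 1) (by norm_cast)).differentiable one_ne_zero
  have key : ∀ (a b : Fin N) x, pd a (pd b f) x =
      fderiv ℝ (fderiv ℝ f) x (Pi.single a 1) (Pi.single b 1) := by
    intro a b x
    simp only [pd]
    rw [show pd b f = fun y => fderiv ℝ f y (Pi.single b 1) from rfl,
      fderiv_clm_apply (hd x) (differentiableAt_const _)]
    simp
  funext x
  rw [key, key]
  have hs : IsSymmSndFDerivAt ℝ f x :=
    hf.contDiffAt.isSymmSndFDerivAt (by simp; norm_cast)
  exact hs.eq _ _

namespace TorusSmooth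

lemma differentiable (hf : TorusSmooth f) : Differentiable ℝ f :=
  hf.contDiff.differentiable (by simp)

lemma contDiff_one (hf : TorusSmooth f) : ContDiff ℝ 1 f := hf.contDiff.of_le (by norm_cast)

lemma continuous (hf : TorusSmooth f) : Continuous f := hf.contDiff.continuous

lemma pd (hf : TorusSmooth f) (j : Fin N) : TorusSmooth (pd j f) := by
  refine ⟨hf.contDiff.pd j, fun x i => ?_⟩
  simp only [_root_.pd]
  rw [← fderiv_comp_add_right]
  simp only [hf.periodic]

end TorusSmooth

end Calculus

section Integration

variable {N : ℕ} {f g h : (Fin N → ℝ) → ℝ}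

lemma unitBox_ae_eq_Icc (N : ℕ) : unitBox N =ᵐ[volume] Icc (0 : Fin N → ℝ) 1 :=
  Measure.univ_pi_Ico_ae_eq_Icc (f := (0 : Fin N → ℝ)) (g := 1)

lemma boxMeasure_eq (N : ℕ) : boxMeasure N = volume.restrict (Icc (0 : Fin N → ℝ) 1) :=
  Measure.restrict_congr_set (unitBox_ae_eq_Icc N)

instance (N : ℕ) : IsFiniteMeasure (boxMeasure N) := by
  rw [boxMeasure_eq]
  exact ⟨by simpa using isCompact_Icc.measure_lt_top⟩

lemma Continuous.memLp_box (hf : Continuous f) (p : ℝ≥0∞) : MemLp f p (boxMeasure N) := by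
  obtain ⟨C, hC⟩ := isCompact_Icc.exists_bound_of_continuousOn
    (s := Icc (0 : Fin N → ℝ) 1) hf.continuousOn
  refine MemLp.of_bound hf.aestronglyMeasurable C ?_
  rw [boxMeasure_eq]
  exact (ae_restrict_iff' measurableSet_Icc).2 (.of_forall hC)

lemma Continuous.integrable_box (hf : Continuous f) : Integrable f (boxMeasure N) :=
  memLp_one_iff_integrable.1 (hf.memLp_box 1)

/-- The integral of a directional derivative over the unit box vanishes when the boundary values on
the two opposite faces agree. -/
lemma integral_pd_eq_zero (j : Fin N) (hh : ContDiff ℝ 1 h)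
    (hper : ∀ x, x j = 0 → h (x + Pi.single j 1) = h x) :
    ∫ x, pd j h x ∂boxMeasure N = 0 := by
  rw [boxMeasure_eq]
  cases N with
  | zero => exact j.elim0
  | succ n =>
    have key := integral_divergence_of_hasFDerivAt_off_countable' (n := n) (E := ℝ)
      (0 : Fin (n + 1) → ℝ) 1 zero_le_one
      (fun i => if i = j then h else 0) (fun i => if i = j then fderiv ℝ h else 0) ∅ countable_empty
      (fun i => by
        split_ifs
        · exact hh.continuous.continuousOn
        · exact continuousOn_const)
      (fun x _ i => by
        split_ifs
        · exact (hh.differentiable one_ne_zero x).hasFDerivAt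
        · exact hasFDerivAt_const _ _)
    have hsum : ∀ x, (∑ i, (if i = j then fderiv ℝ h else 0) x (Pi.single i 1)) = pd j h x := by
      intro x
      rw [Finset.sum_eq_single j]
      · simp [pd]
      · intro b _ hb
        simp [hb]
      · simp
    simp only [hsum] at key
    rw [key ((continuous_pd j hh).continuousOn.integrableOn_compact isCompact_Icc)]
    refine Finset.sum_eq_zero fun i _ => ?_
    by_cases hi : i = j
    · subst hi
      rw [sub_eq_zero]
      refine setIntegral_congr_fun measurableSet_Icc fun x _ => ?_
      have := hper (i.insertNth 0 x) (by simp)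
      simp only [if_true, Pi.one_apply, Pi.zero_apply]
      rw [← this]
      congr 1
      funext l
      refine Fin.succAboveCases i ?_ (fun m => ?_) l
      · simp
      · simp [Fin.succAbove_ne]
    · simp [hi]

lemma integral_pd_mul (j : Fin N) (hf : ContDiff ℝ 1 f) (hg : ContDiff ℝ 1 g)
    (hper : ∀ x, x j = 0 → f (x + Pi.single j 1) * g (x + Pi.single j 1) = f x * g x) :
    ∫ x, pd j f x * g x ∂boxMeasure N = -∫ x, f x * pd j g x ∂boxMeasure N := by
  have h0 := integral_pd_eq_zero j (hf.mul hg) hper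
  change ∫ x, pd j (f * g) x ∂boxMeasure N = 0 at h0
  rw [pd_mul j (hf.differentiable one_ne_zero) (hg.differentiable one_ne_zero)] at h0
  simp only [Pi.add_apply, Pi.mul_apply] at h0
  rw [integral_add] at h0
  · linarith
  · exact ((continuous_pd j hf).mul hg.continuous).integrable_box
  · exact (hf.continuous.mul (continuous_pd j hg)).integrable_box

end Integration

section Norms

variable {N : ℕ} {f g h : (Fin N → ℝ) → ℝ}

lemma eLpNorm_mul_le_of_continuous {p q r : ℝ≥0∞} (hf : Continuous f) (hg : Continuous g)
    (hpqr : ENNReal.HolderTriple p q r) :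
    eLpNorm (fun x => f x * g x) r (boxMeasure N) ≤
      eLpNorm f p (boxMeasure N) * eLpNorm g q (boxMeasure N) := by
  simpa using eLpNorm_le_eLpNorm_mul_eLpNorm_of_nnnorm (μ := boxMeasure N) (r := r)
    hf.aestronglyMeasurable hg.aestronglyMeasurable (fun a b : ℝ => a * b) 1
    (.of_forall fun x => by simp)

lemma eLpNorm_rpow_eq_integral (hf : Continuous f) {p : ℝ} (hp : 0 < p) :
    eLpNorm f (ENNReal.ofReal p) (boxMeasure N) ^ p =
      ENNReal.ofReal (∫ x, |f x| ^ p ∂boxMeasure N) := by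
  rw [(hf.memLp_box _).eLpNorm_eq_integral_rpow_norm (by simpa using hp) ENNReal.ofReal_ne_top,
    ENNReal.toReal_ofReal hp.le, ENNReal.ofReal_rpow_of_nonneg (by positivity) hp.le,
    Real.rpow_inv_rpow (by positivity) hp.ne']
  rfl

lemma hasDerivAt_mul_abs_rpow {s : ℝ} (hs : 0 < s) (t : ℝ) :
    HasDerivAt (fun t : ℝ => t * |t| ^ s) ((s + 1) * |t| ^ s) t := by
  have hcont : Continuous fun t : ℝ => |t| ^ s := continuous_abs.rpow_const fun _ => Or.inr hs.le
  rcases eq_or_ne t 0 with rfl | ht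
  · rw [hasDerivAt_iff_tendsto_slope]
    have h0 := (hcont.tendsto 0).mono_left (nhdsWithin_le_nhds (s := {0}ᶜ))
    simp only [abs_zero, Real.zero_rpow hs.ne', mul_zero] at h0 ⊢
    refine h0.congr' ?_
    filter_upwards [self_mem_nhdsWithin] with x hx
    have hx : x ≠ 0 := hx
    simp [slope_def_field, hx]
  · have h1 := (hasDerivAt_abs ht).rpow_const (p := s) (Or.inl (abs_ne_zero.2 ht))
    refine ((hasDerivAt_id' t).mul h1).congr_deriv ?_
    have h2 : |t| ^ s = |t| ^ (s - 1) * |t| := by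
      rw [← Real.rpow_add_one (abs_ne_zero.2 ht)]
      ring_nf
    have h3 : t * (SignType.sign t : ℝ) = |t| := by
      rw [mul_comm]
      exact sign_mul_self t
    linear_combination -s * h2 + s * |t| ^ (s - 1) * h3

/-- The basic interpolation inequality between three consecutive derivatives. -/
lemma eLpNorm_pd_sq_le (hf : TorusSmooth f) (j : Fin N) {p : ℝ} (hp : 2 < p) {q r : ℝ≥0∞}
    (hqr : ENNReal.HolderTriple q r (ENNReal.ofReal (p / 2))) :
    eLpNorm (pd j f) (ENNReal.ofReal p) (boxMeasure N) ^ 2 ≤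
      ENNReal.ofReal (p - 1) * (eLpNorm f q (boxMeasure N) *
        eLpNorm (pd j (pd j f)) r (boxMeasure N)) := by
  set μ := boxMeasure N
  set w := pd j f with hw
  have hwT : TorusSmooth w := hf.pd j
  have hw'T : TorusSmooth (pd j w) := hwT.pd j
  set s := p - 2 with hs
  have hs0 : 0 < s := by linarith
  have hφ := hasDerivAt_mul_abs_rpow hs0
  have habs : Continuous fun t : ℝ => |t| ^ s := continuous_abs.rpow_const fun _ => Or.inr hs0.le
  have hφC : ContDiff ℝ 1 fun t : ℝ => t * |t| ^ s := by
    rw [contDiff_one_iff_deriv]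
    refine ⟨fun t => (hφ t).differentiableAt, ?_⟩
    rw [show deriv (fun t : ℝ => t * |t| ^ s) = fun t => (s + 1) * |t| ^ s from
      funext fun t => (hφ t).deriv]
    exact continuous_const.mul habs
  have hpow : ∀ t : ℝ, |t| ^ p = t * (t * |t| ^ s) := by
    intro t
    rw [show p = s + 2 by rw [hs]; ring, Real.rpow_add' (abs_nonneg t) (by linarith)]
    norm_num
    ring
  have hibp := integral_pd_mul j hf.contDiff_one (hφC.comp hwT.contDiff_one) (fun x _ => by
    simp only [Function.comp_apply, hf.periodic, hwT.periodic])
  set E := eLpNorm w (ENNReal.ofReal p) μ with hE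
  set F : (Fin N → ℝ) → ℝ := fun x => f x * pd j w x * |w x| ^ s with hF
  have hFc : Continuous F := (hf.continuous.mul hw'T.continuous).mul (habs.comp hwT.continuous)
  have h1 : E ^ p ≤ ENNReal.ofReal (p - 1) * eLpNorm F 1 μ := by
    rw [hE, eLpNorm_rpow_eq_integral hwT.continuous (by linarith)]
    have : ∫ x, |w x| ^ p ∂μ = -((p - 1) * ∫ x, F x ∂μ) := by
      rw [← integral_const_mul]
      calc ∫ x, |w x| ^ p ∂μ = ∫ x, pd j f x * (w x * |w x| ^ s) ∂μ := by
            simp only [hpow, hw]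
        _ = _ := hibp
        _ = _ := by
          congr 2
          funext x
          have := congrFun (pd_comp j hφ hwT.differentiable) x
          rw [show (fun t : ℝ => t * |t| ^ s) ∘ w = fun x => w x * |w x| ^ s from rfl, this, hF, hs]
          ring
    rw [this, ← mul_neg, ENNReal.ofReal_mul (by linarith)]
    gcongr
    rw [eLpNorm_one_eq_lintegral_enorm]
    calc ENNReal.ofReal (-∫ x, F x ∂μ) ≤ ENNReal.ofReal ‖∫ x, F x ∂μ‖ :=
          ENNReal.ofReal_le_ofReal (neg_le_abs _)
      _ = ‖∫ x, F x ∂μ‖ₑ := ofReal_norm _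
      _ ≤ _ := enorm_integral_le_lintegral_enorm _
  have h2 : eLpNorm F 1 μ ≤ eLpNorm f q μ * eLpNorm (pd j w) r μ * E ^ s := by
    have hconj : ENNReal.HolderTriple (ENNReal.ofReal (p / 2)) (ENNReal.ofReal (p / s)) 1 := by
      constructor
      rw [← ENNReal.ofReal_inv_of_pos (by linarith), ← ENNReal.ofReal_inv_of_pos (by positivity),
        ← ENNReal.ofReal_add (by positivity) (by positivity), inv_one, ← ENNReal.ofReal_one]
      congr 1
      rw [hs]
      field_simp
      ring
    refine (eLpNorm_mul_le_of_continuous (hf.continuous.mul hw'T.continuous)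
      (habs.comp hwT.continuous) hconj).trans ?_
    refine mul_le_mul' (eLpNorm_mul_le_of_continuous hf.continuous hw'T.continuous hqr) ?_
    refine le_of_eq ?_
    change eLpNorm (fun x => ‖w x‖ ^ s) _ μ = _
    rw [eLpNorm_norm_rpow _ hs0, ← ENNReal.ofReal_mul (by positivity),
      div_mul_cancel₀ _ hs0.ne']
  rcases eq_or_ne E 0 with h0 | h0
  · simp [h0]
  have htop : E ≠ ⊤ := (hwT.continuous.memLp_box _).eLpNorm_ne_top
  have hEs0 : E ^ s ≠ 0 := by simp [h0, htop]
  have hEst : E ^ s ≠ ⊤ := by simp [h0, htop]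
  rw [← ENNReal.mul_le_mul_iff_left hEs0 hEst]
  calc E ^ 2 * E ^ s = E ^ p := by
        rw [← ENNReal.rpow_natCast, ← ENNReal.rpow_add _ _ h0 htop, hs]
        norm_num
    _ ≤ _ := h1
    _ ≤ _ := by
      rw [mul_assoc]
      gcongr

/-- Poincaré inequality for a function which is itself a derivative in the same direction. -/
lemma eLpNorm_pd_le_pd_pd (hf : TorusSmooth f) (j : Fin N) :
    eLpNorm (pd j f) 2 (boxMeasure N) ≤ 2 * eLpNorm (pd j (pd j f)) 2 (boxMeasure N) := by
  set w := pd j f with hw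
  have hwT : TorusSmooth w := hf.pd j
  have hw'T : TorusSmooth (pd j w) := hwT.pd j
  set v : (Fin N → ℝ) → ℝ := fun x => f x - f (x - x j • Pi.single j 1) with hv
  have hxj : ContDiff ℝ 1 fun x : Fin N → ℝ => x j := contDiff_apply ℝ ℝ j
  have hxj' : ∀ x, HasFDerivAt (fun x : Fin N → ℝ => x j)
      (ContinuousLinearMap.proj j : (Fin N → ℝ) →L[ℝ] ℝ) x := fun x => hasFDerivAt_apply j x
  have hproj : ContDiff ℝ 1 fun x : Fin N → ℝ => x - x j • (Pi.single j 1 : Fin N → ℝ) :=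
    contDiff_id.sub (hxj.smul contDiff_const)
  have hvC : ContDiff ℝ 1 v := hf.contDiff_one.sub (hf.contDiff_one.comp hproj)
  have hv' : pd j v = w := by
    funext x
    have h1 : HasFDerivAt (fun x : Fin N → ℝ => x - x j • (Pi.single j 1 : Fin N → ℝ)) _ x :=
      (hasFDerivAt_id x).sub ((hxj' x).smul_const (Pi.single j 1))
    have h2 := (hf.differentiable x).hasFDerivAt.sub
      ((hf.differentiable _).hasFDerivAt.comp x h1)
    change fderiv ℝ v x _ = _
    rw [show v = f - f ∘ fun x : Fin N → ℝ => x - x j • (Pi.single j 1 : Fin N → ℝ) from rfl,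
      h2.fderiv]
    simp [hw, pd]
  have hv0 : ∀ x, x j = 0 → v x = 0 := fun x hx => by simp [hv, hx]
  have hv1 : ∀ x, v (x + Pi.single j 1) = v x := fun x => by
    simp only [hv, hf.periodic, Pi.add_apply, Pi.single_eq_same, add_smul, one_smul]
    congr 2
    abel
  have hvc := hvC.continuous
  have hwc := hwT.continuous
  have hw'c := hw'T.continuous
  have hA : ∫ x, w x ^ 2 ∂boxMeasure N = -∫ x, v x * pd j w x ∂boxMeasure N := by
    have := integral_pd_mul j hvC hwT.contDiff_one
      (fun x _ => by rw [hv1, hwT.periodic])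
    rw [hv'] at this
    simpa only [sq] using this
  have hT : ∫ x, v x ^ 2 ∂boxMeasure N =
      -∫ x, (x j - 1) * (2 * v x * w x) ∂boxMeasure N := by
    have hlin : pd j (fun x : Fin N → ℝ => x j - 1) = fun _ => 1 := by
      funext x
      have h1 : HasFDerivAt (fun x : Fin N → ℝ => x j - 1) _ x :=
        (hxj' x).sub_const 1
      simp [pd, h1.fderiv]
    have hsq : pd j (fun x => v x ^ 2) = fun x => 2 * v x * w x := by
      rw [pd_comp j (φ := fun t => t ^ 2) (φ' := fun t => 2 * t)
        (fun t => by simpa using hasDerivAt_pow 2 t)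
        (hvC.differentiable one_ne_zero), hv']
    have := integral_pd_mul (f := fun x => x j - 1) (g := fun x => v x ^ 2) j
      (hxj.sub contDiff_const) (hvC.pow 2) (fun x hx => by simp [hv1, hv0 x hx])
    rw [hlin, hsq] at this
    simpa using this
  have hT' : ∫ x, v x ^ 2 ∂boxMeasure N ≤ 4 * ∫ x, w x ^ 2 ∂boxMeasure N := by
    have : -∫ x, (x j - 1) * (2 * v x * w x) ∂boxMeasure N ≤
        ∫ x, (1 / 2 * v x ^ 2 + 2 * w x ^ 2) ∂boxMeasure N := by
      rw [← integral_neg]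
      refine integral_mono_ae ?_ ?_ ?_
      · exact (Continuous.integrable_box (by fun_prop))
      · exact (Continuous.integrable_box (by fun_prop))
      · refine (ae_restrict_iff' (MeasurableSet.univ_pi fun _ => measurableSet_Ico)).2
          (.of_forall fun x hx => ?_)
        have h1 := (hx j (mem_univ j)).1
        have h2 := (hx j (mem_univ j)).2.le
        have h3 : (1 - x j) ^ 2 ≤ 1 := by nlinarith
        simp only
        nlinarith [sq_nonneg (v x - 2 * ((1 - x j) * w x)),
          mul_le_mul_of_nonneg_right h3 (sq_nonneg (w x))]
    rw [integral_add (Continuous.integrable_box (by fun_prop))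
      (Continuous.integrable_box (by fun_prop)), integral_const_mul, integral_const_mul] at this
    linarith
  have hA' : ∫ x, w x ^ 2 ∂boxMeasure N ≤ 4 * ∫ x, pd j w x ^ 2 ∂boxMeasure N := by
    have : -∫ x, v x * pd j w x ∂boxMeasure N ≤
        ∫ x, (1 / 8 * v x ^ 2 + 2 * pd j w x ^ 2) ∂boxMeasure N := by
      rw [← integral_neg]
      refine integral_mono ?_ ?_ fun x => ?_
      · exact (Continuous.integrable_box (by fun_prop))
      · exact (Continuous.integrable_box (by fun_prop))
      · simp only
        nlinarith [sq_nonneg (v x + 4 * pd j w x)]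
    rw [integral_add (Continuous.integrable_box (by fun_prop))
      (Continuous.integrable_box (by fun_prop)), integral_const_mul, integral_const_mul] at this
    linarith
  have hsq : ∀ {u : (Fin N → ℝ) → ℝ}, Continuous u →
      eLpNorm u 2 (boxMeasure N) ^ (2 : ℝ) = ENNReal.ofReal (∫ x, u x ^ 2 ∂boxMeasure N) := by
    intro u hu
    simpa using eLpNorm_rpow_eq_integral hu (p := 2) two_pos
  rw [← ENNReal.rpow_le_rpow_iff (z := 2) two_pos, ENNReal.mul_rpow_of_nonneg _ _ zero_le_two,
    hsq hwc, hsq hw'c]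
  refine (ENNReal.ofReal_le_ofReal hA').trans ?_
  rw [ENNReal.ofReal_mul (by norm_num)]
  norm_num

end Norms

section Words

variable {N : ℕ} {f g : (Fin N → ℝ) → ℝ}

/-- Iterated partial derivative along a list of directions. -/
def wordDeriv (L : List (Fin N)) (f : (Fin N → ℝ) → ℝ) : (Fin N → ℝ) → ℝ := L.foldr pd f

@[simp] lemma wordDeriv_nil (f : (Fin N → ℝ) → ℝ) : wordDeriv [] f = f := rfl

@[simp] lemma wordDeriv_cons (j : Fin N) (L : List (Fin N)) (f : (Fin N → ℝ) → ℝ) :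
    wordDeriv (j :: L) f = pd j (wordDeriv L f) := rfl

lemma wordDeriv_append (L M : List (Fin N)) (f : (Fin N → ℝ) → ℝ) :
    wordDeriv (L ++ M) f = wordDeriv L (wordDeriv M f) := List.foldr_append

lemma TorusSmooth.wordDeriv (hf : TorusSmooth f) (L : List (Fin N)) :
    TorusSmooth (wordDeriv L f) := by
  induction L with
  | nil => exact hf
  | cons j L ih => exact ih.pd j

lemma List.Perm.wordDeriv_eq {L M : List (Fin N)} (h : L.Perm M) (hf : TorusSmooth f) :
    wordDeriv L f = wordDeriv M f := by
  induction h with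
  | nil => rfl
  | cons j _ ih => simp [ih]
  | swap i j L => exact pd_comm _ _ (hf.wordDeriv L).contDiff
  | trans _ _ h1 h2 => exact h1.trans h2

/-- The list of directions of a multi-index, in increasing order. -/
def multiIndexWord (α : Fin N → ℕ) : List (Fin N) :=
  (List.finRange N).flatMap fun j => List.replicate (α j) j

lemma Dalpha_eq_wordDeriv (α : Fin N → ℕ) (f : (Fin N → ℝ) → ℝ) :
    Dalpha α f = wordDeriv (multiIndexWord α) f := by
  have hrep : ∀ (j : Fin N) (n : ℕ) (h : (Fin N → ℝ) → ℝ),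
      (pd j)^[n] h = wordDeriv (List.replicate n j) h := by
    intro j n h
    induction n with
    | zero => rfl
    | succ n ih => rw [Function.iterate_succ_apply', ih]; rfl
  rw [Dalpha, multiIndexWord, List.ofFn_eq_map]
  induction List.finRange N with
  | nil => rfl
  | cons j l ih =>
    rw [List.flatMap_cons, wordDeriv_append, ← ih, ← hrep]
    rfl

lemma length_multiIndexWord (α : Fin N → ℕ) : (multiIndexWord α).length = ∑ j, α j := by
  simp [multiIndexWord, List.length_flatMap, Fin.sum_univ_def]

lemma multiIndexWord_count_perm (L : List (Fin N)) :
    (multiIndexWord fun j => L.count j).Perm L := by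
  rw [List.perm_iff_count]
  intro a
  rw [multiIndexWord, List.count_flatMap, ← Fin.sum_univ_def, Finset.sum_eq_single a]
  · simp
  · intro b _ hb
    simp [List.count_replicate, hb]
  · simp

/-- Largest `L^p` norm on the torus among the partial derivatives of order `i`. -/
def derivNorm (f : (Fin N → ℝ) → ℝ) (i : ℕ) (p : ℝ≥0∞) : ℝ≥0∞ :=
  ⨆ L : {L : List (Fin N) // L.length = i}, eLpNorm (wordDeriv L.1 f) p (boxMeasure N)

lemma le_derivNorm (f : (Fin N → ℝ) → ℝ) {L : List (Fin N)} {i : ℕ} (hL : L.length = i)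
    (p : ℝ≥0∞) : eLpNorm (wordDeriv L f) p (boxMeasure N) ≤ derivNorm f i p :=
  le_iSup (fun L : {L : List (Fin N) // L.length = i} =>
    eLpNorm (wordDeriv L.1 f) p (boxMeasure N)) ⟨L, hL⟩

lemma derivNorm_zero (f : (Fin N → ℝ) → ℝ) (p : ℝ≥0∞) :
    derivNorm f 0 p = eLpNorm f p (boxMeasure N) := by
  refine le_antisymm (iSup_le ?_) (le_derivNorm f (L := []) rfl p)
  rintro ⟨L, hL⟩
  rw [List.length_eq_zero_iff] at hL
  subst hL
  rfl

lemma derivNorm_ne_top (hf : TorusSmooth f) (i : ℕ) (p : ℝ≥0∞) : derivNorm f i p ≠ ⊤ := by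
  have hfin : Finite {L : List (Fin N) // L.length = i} := List.finite_length_eq (Fin N) i
  rw [derivNorm]
  rcases isEmpty_or_nonempty {L : List (Fin N) // L.length = i} with h | h
  · simp
  · obtain ⟨L, hL⟩ := exists_eq_ciSup_of_finite
      (f := fun L : {L : List (Fin N) // L.length = i} =>
        eLpNorm (wordDeriv L.1 f) p (boxMeasure N))
    rw [← hL]
    exact ((hf.wordDeriv L.1).continuous.memLp_box p).eLpNorm_ne_top

lemma derivNorm_le_iSup_Dalpha (hf : TorusSmooth f) (i : ℕ) (p : ℝ≥0∞) :
    derivNorm f i p ≤ ⨆ (β : Fin N → ℕ) (_ : (∑ j, β j) = i),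
      eLpNorm (Dalpha β f) p (boxMeasure N) := by
  refine iSup_le ?_
  rintro ⟨L, hL⟩
  have hperm := multiIndexWord_count_perm L
  rw [← hperm.wordDeriv_eq hf, ← Dalpha_eq_wordDeriv]
  refine le_iSup₂ (f := fun (β : Fin N → ℕ) (_ : (∑ j, β j) = i) =>
    eLpNorm (Dalpha β f) p (boxMeasure N)) (fun j => L.count j) ?_
  rw [← length_multiIndexWord, hperm.length_eq, hL]

lemma derivNorm_pd_le (f : (Fin N → ℝ) → ℝ) (j : Fin N) (i : ℕ) (p : ℝ≥0∞) :
    derivNorm (pd j f) i p ≤ derivNorm f (i + 1) p := by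
  refine iSup_le ?_
  rintro ⟨L, hL⟩
  have := le_derivNorm f (L := L ++ [j]) (i := i + 1) (by simp [hL]) p
  rwa [wordDeriv_append] at this

lemma derivNorm_le_succ (hf : TorusSmooth f) {i : ℕ} (hi : 0 < i) :
    derivNorm f i 2 ≤ 2 * derivNorm f (i + 1) 2 := by
  refine iSup_le ?_
  rintro ⟨L, hL⟩
  cases L with
  | nil => simp at hL; omega
  | cons j L =>
    refine (eLpNorm_pd_le_pd_pd (hf.wordDeriv L) j).trans ?_
    gcongr
    exact le_derivNorm f (L := j :: j :: L) (by simpa using hL) 2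

lemma derivNorm_le_of_le (hf : TorusSmooth f) {i k : ℕ} (hi : 0 < i) (hk : i ≤ k) :
    derivNorm f i 2 ≤ 2 ^ (k - i) * derivNorm f k 2 := by
  induction k, hk using Nat.le_induction with
  | base => simp
  | succ k hk ih =>
    refine ih.trans ?_
    rw [Nat.sub_add_comm hk, pow_succ, mul_assoc]
    gcongr
    exact derivNorm_le_succ hf (hi.trans_le hk)

end Words

section Interpolation

/-- A log-convex finite sequence lies below its geometric interpolation between the endpoints. -/
lemma ENNReal.pow_le_of_logConvex {b : ℕ → ℝ≥0∞} {n : ℕ} (hb : ∀ i, b i ≠ ⊤)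
    (h : ∀ i, i + 1 < n → b (i + 1) ^ 2 ≤ b i * b (i + 2)) {i : ℕ} (hi : i ≤ n) :
    b i ^ n ≤ b 0 ^ (n - i) * b n ^ i := by
  have hstep : ∀ i, i < n → b i ^ (i + 1) ≤ b 0 * b (i + 1) ^ i := by
    intro i
    induction i with
    | zero => simp
    | succ i ih =>
      intro hi
      rcases eq_or_ne (b (i + 1)) 0 with h0 | h0
      · simp [h0]
      rw [← ENNReal.mul_le_mul_iff_left (pow_ne_zero i h0) (ENNReal.pow_ne_top (hb _))]
      calc b (i + 1) ^ (i + 1 + 1) * b (i + 1) ^ i = (b (i + 1) ^ 2) ^ (i + 1) := by ring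
        _ ≤ (b i * b (i + 2)) ^ (i + 1) := by gcongr; exact h i hi
        _ = b i ^ (i + 1) * b (i + 2) ^ (i + 1) := mul_pow _ _ _
        _ ≤ b 0 * b (i + 1) ^ i * b (i + 2) ^ (i + 1) := by gcongr; exact ih (by omega)
        _ = _ := by ring
  have main : ∀ j, i ≤ j → j ≤ n → b i ^ j ≤ b 0 ^ (j - i) * b j ^ i := by
    intro j hij
    induction j, hij using Nat.le_induction with
    | base => simp
    | succ j hij ih =>
      intro hj
      rcases Nat.eq_zero_or_pos j with rfl | hj0
      · obtain rfl : i = 0 := by omega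
        simp
      rw [← ENNReal.pow_le_pow_left_iff hj0.ne']
      obtain ⟨d, rfl⟩ := Nat.exists_eq_add_of_le hij
      rw [show i + d + 1 - i = d + 1 by omega]
      have ih := ih (by omega)
      rw [show i + d - i = d by omega] at ih
      calc (b i ^ (i + d + 1)) ^ (i + d) = (b i ^ (i + d)) ^ (i + d + 1) := by ring
        _ ≤ (b 0 ^ d * b (i + d) ^ i) ^ (i + d + 1) := by gcongr
        _ = b 0 ^ (d * (i + d + 1)) * (b (i + d) ^ (i + d + 1)) ^ i := by ring
        _ ≤ b 0 ^ (d * (i + d + 1)) * (b 0 * b (i + d + 1) ^ (i + d)) ^ i := by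
          gcongr
          exact hstep _ (by omega)
        _ = _ := by ring
  exact main n hi le_rfl

/-- The exponent `2 n / i` of Gagliardo–Nirenberg interpolation. -/
def interpExponent (n i : ℕ) : ℝ≥0∞ := ((i : ℝ≥0∞) / (2 * n))⁻¹

lemma interpExponent_zero {n : ℕ} : interpExponent n 0 = ⊤ := by
  simp [interpExponent]

lemma interpExponent_self {n : ℕ} (hn : 0 < n) : interpExponent n n = 2 := by
  have : (n : ℝ≥0∞) ≠ 0 := by exact_mod_cast hn.ne'
  rw [interpExponent, ENNReal.inv_div (by simp) (by simp [this]),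
    ENNReal.mul_div_cancel_right this (by simp)]

lemma interpExponent_eq_ofReal {n i : ℕ} (hn : 0 < n) (hi : 0 < i) :
    interpExponent n i = ENNReal.ofReal (2 * n / i) := by
  have hn' : (0 : ℝ) < n := by exact_mod_cast hn
  have hi' : (0 : ℝ) < i := by exact_mod_cast hi
  rw [interpExponent, ENNReal.inv_div (by simp) (by simp [hi.ne']), ENNReal.ofReal_div_of_pos hi',
    ENNReal.ofReal_mul zero_le_two]
  simp

lemma holderTriple_interpExponent (n i l : ℕ) :
    ENNReal.HolderTriple (interpExponent n i) (interpExponent n l) (interpExponent n (i + l)) := by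
  constructor
  simp only [interpExponent, inv_inv]
  rw [← ENNReal.add_div]
  push_cast
  rfl

variable {N : ℕ} {f g : (Fin N → ℝ) → ℝ}

lemma derivNorm_sq_le (hf : TorusSmooth f) {n i : ℕ} (hi : i + 1 < n) :
    derivNorm f (i + 1) (interpExponent n (i + 1)) ^ 2 ≤
      (2 * n : ℕ) * (derivNorm f i (interpExponent n i) *
        derivNorm f (i + 2) (interpExponent n (i + 2))) := by
  have hn' : (0 : ℝ) < n := by exact_mod_cast (by omega : 0 < n)
  have hi' : (i : ℝ) + 1 < n := by exact_mod_cast hi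
  have hi0 : (0 : ℝ) < (i : ℝ) + 1 := by positivity
  set p : ℝ := 2 * n / (i + 1 : ℕ) with hp
  have hp2 : 2 < p := by
    rw [hp, lt_div_iff₀ (by positivity)]
    push_cast
    linarith
  have hpn : p - 1 ≤ (2 * n : ℕ) := by
    have : p ≤ 2 * n := div_le_self (by positivity) (by push_cast; linarith)
    push_cast
    linarith
  have hqr : ENNReal.HolderTriple (interpExponent n i) (interpExponent n (i + 2))
      (ENNReal.ofReal (p / 2)) := by
    convert holderTriple_interpExponent n i (i + 2) using 1
    rw [interpExponent_eq_ofReal (by omega) (by omega), hp]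
    congr 1
    push_cast
    field_simp
    ring
  rw [derivNorm, ENNReal.iSup_pow_of_ne_zero two_ne_zero]
  refine iSup_le ?_
  rintro ⟨L, hL⟩
  cases L with
  | nil => simp at hL
  | cons j L =>
    rw [interpExponent_eq_ofReal (by omega) (by omega)]
    refine (eLpNorm_pd_sq_le (hf.wordDeriv L) j hp2 hqr).trans ?_
    refine mul_le_mul' ?_ (mul_le_mul' (le_derivNorm f (by simpa using hL) _)
      (le_derivNorm f (L := j :: j :: L) (by simpa using hL) _))
    exact (ENNReal.ofReal_le_ofReal hpn).trans (by rw [ENNReal.ofReal_natCast])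

/-- Gagliardo–Nirenberg interpolation between `L^∞` and the `L²` norm of the derivatives of
order `n`. -/
lemma derivNorm_pow_le (hf : TorusSmooth f) {n i : ℕ} (hn : 0 < n) (hi : i ≤ n) :
    derivNorm f i (interpExponent n i) ^ n ≤
      ((2 * n : ℕ) : ℝ≥0∞) ^ (n ^ 2 * i) *
        (eLpNorm f ⊤ (boxMeasure N) ^ (n - i) * derivNorm f n 2 ^ i) := by
  set c : ℝ≥0∞ := ((2 * n : ℕ) : ℝ≥0∞) with hc
  have hc1 : 1 ≤ c := by
    rw [hc]
    exact_mod_cast (by omega : 1 ≤ 2 * n)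
  have hctop : c ≠ ⊤ := ENNReal.natCast_ne_top _
  have key := ENNReal.pow_le_of_logConvex (n := n)
    (b := fun i => c ^ i ^ 2 * derivNorm f i (interpExponent n i))
    (fun i => ENNReal.mul_ne_top (ENNReal.pow_ne_top hctop) (derivNorm_ne_top hf _ _))
    (fun i hi => by
      calc (c ^ (i + 1) ^ 2 * derivNorm f (i + 1) (interpExponent n (i + 1))) ^ 2
          = c ^ (2 * (i + 1) ^ 2) * derivNorm f (i + 1) (interpExponent n (i + 1)) ^ 2 := by ring
        _ ≤ c ^ (2 * (i + 1) ^ 2) * (c * (derivNorm f i (interpExponent n i) *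
              derivNorm f (i + 2) (interpExponent n (i + 2)))) := by
          gcongr
          exact derivNorm_sq_le hf hi
        _ = c ^ (2 * (i + 1) ^ 2 + 1) * (derivNorm f i (interpExponent n i) *
              derivNorm f (i + 2) (interpExponent n (i + 2))) := by ring
        _ ≤ c ^ (i ^ 2 + (i + 2) ^ 2) * (derivNorm f i (interpExponent n i) *
              derivNorm f (i + 2) (interpExponent n (i + 2))) := by
          refine mul_le_mul' (pow_le_pow_right₀ hc1 ?_) le_rfl
          nlinarith
        _ = _ := by ring)
    hi
  simp only [interpExponent_zero, interpExponent_self hn, derivNorm_zero] at key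
  calc derivNorm f i (interpExponent n i) ^ n
      ≤ (c ^ i ^ 2 * derivNorm f i (interpExponent n i)) ^ n := by
        gcongr
        exact le_mul_of_one_le_left' (one_le_pow₀ hc1)
    _ ≤ _ := key
    _ = _ := by
      norm_num
      ring

/-- Moser's product estimate. -/
lemma eLpNorm_wordDeriv_mul_le (hf : TorusSmooth f) (hg : TorusSmooth g) {L M : List (Fin N)}
    {n : ℕ} (hn : 0 < n) (hLM : L.length + M.length = n) :
    eLpNorm (wordDeriv L f * wordDeriv M g) 2 (boxMeasure N) ≤
      ((2 * n : ℕ) : ℝ≥0∞) ^ n ^ 2 *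
        (eLpNorm f ⊤ (boxMeasure N) * derivNorm g n 2 +
          eLpNorm g ⊤ (boxMeasure N) * derivNorm f n 2) := by
  set c : ℝ≥0∞ := ((2 * n : ℕ) : ℝ≥0∞)
  set i := L.length with hi
  set l := M.length with hl
  set U := eLpNorm f ⊤ (boxMeasure N)
  set V := eLpNorm g ⊤ (boxMeasure N)
  have hholder := holderTriple_interpExponent n i l
  rw [hLM, interpExponent_self hn] at hholder
  have h1 : eLpNorm (wordDeriv L f * wordDeriv M g) 2 (boxMeasure N) ≤
      derivNorm f i (interpExponent n i) * derivNorm g l (interpExponent n l) :=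
    (eLpNorm_mul_le_of_continuous (hf.wordDeriv L).continuous (hg.wordDeriv M).continuous
      hholder).trans (mul_le_mul' (le_derivNorm f rfl _) (le_derivNorm g rfl _))
  have hf' := derivNorm_pow_le hf hn (by omega : i ≤ n)
  have hg' := derivNorm_pow_le hg hn (by omega : l ≤ n)
  rw [show n - i = l by omega] at hf'
  rw [show n - l = i by omega] at hg'
  rw [← ENNReal.pow_le_pow_left_iff hn.ne']
  set S := U * derivNorm g n 2 + V * derivNorm f n 2
  calc _ ≤ (derivNorm f i (interpExponent n i) * derivNorm g l (interpExponent n l)) ^ n := by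
        gcongr
    _ = derivNorm f i (interpExponent n i) ^ n * derivNorm g l (interpExponent n l) ^ n :=
        mul_pow _ _ _
    _ ≤ (c ^ (n ^ 2 * i) * (U ^ l * derivNorm f n 2 ^ i)) *
          (c ^ (n ^ 2 * l) * (V ^ i * derivNorm g n 2 ^ l)) := mul_le_mul' hf' hg'
    _ = c ^ (n ^ 2 * (i + l)) * ((U * derivNorm g n 2) ^ l * (V * derivNorm f n 2) ^ i) := by ring
    _ ≤ c ^ (n ^ 2 * (i + l)) * (S ^ l * S ^ i) := by
        gcongr
        · exact le_self_add
        · exact le_add_self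
    _ = _ := by
        rw [hLM, ← pow_add, add_comm l i, hLM, mul_pow, ← pow_mul]

end Interpolation

section Commutator

variable {N : ℕ} {f g : (Fin N → ℝ) → ℝ}

lemma differentiable_list_sum {l : List ((Fin N → ℝ) → ℝ)} (hl : ∀ h ∈ l, Differentiable ℝ h) :
    Differentiable ℝ l.sum := by
  induction l with
  | nil => exact differentiable_const 0
  | cons h l ih =>
    rw [List.forall_mem_cons] at hl
    exact hl.1.add (ih hl.2)

lemma pd_list_sum (j : Fin N) {l : List ((Fin N → ℝ) → ℝ)} (hl : ∀ h ∈ l, Differentiable ℝ h) :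
    pd j l.sum = (l.map (pd j)).sum := by
  induction l with
  | nil =>
    funext x
    simp [pd]
  | cons h l ih =>
    rw [List.forall_mem_cons] at hl
    rw [List.sum_cons, pd_add j hl.1 (differentiable_list_sum hl.2), ih hl.2]
    rfl

/-- The Leibniz rule, with the term in which no derivative falls on `f` split off. -/
lemma exists_wordDeriv_mul_eq (L : List (Fin N)) :
    ∃ T : List (List (Fin N) × List (Fin N)),
      (∀ P ∈ T, P.1 ≠ [] ∧ P.1.length + P.2.length = L.length) ∧
      ∀ f g : (Fin N → ℝ) → ℝ, TorusSmooth f → TorusSmooth g →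
        wordDeriv L (f * g) =
          f * wordDeriv L g + (T.map fun P => wordDeriv P.1 f * wordDeriv P.2 g).sum := by
  induction L with
  | nil => exact ⟨[], by simp, by simp⟩
  | cons j L ih =>
    obtain ⟨T, hT, hsum⟩ := ih
    refine ⟨([j], L) :: (T.map (fun P => (j :: P.1, P.2)) ++ T.map fun P => (P.1, j :: P.2)),
      ?_, fun f g hf hg => ?_⟩
    · simp only [List.mem_cons, List.mem_append, List.mem_map]
      rintro P (rfl | ⟨Q, hQ, rfl⟩ | ⟨Q, hQ, rfl⟩)
      · simp [add_comm]
      · have := hT Q hQ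
        simp
        omega
      · have := hT Q hQ
        refine ⟨this.1, ?_⟩
        simp
        omega
    · have hd : ∀ h ∈ T.map fun P => wordDeriv P.1 f * wordDeriv P.2 g, Differentiable ℝ h := by
        simp only [List.mem_map]
        rintro h ⟨P, -, rfl⟩
        exact (hf.wordDeriv P.1).differentiable.mul (hg.wordDeriv P.2).differentiable
      have hDg := (hg.wordDeriv L).differentiable
      rw [wordDeriv_cons, hsum f g hf hg,
        pd_add j (hf.differentiable.mul hDg) (differentiable_list_sum hd),
        pd_mul j hf.differentiable hDg, pd_list_sum j hd]
      have hprod : ∀ P : List (Fin N) × List (Fin N),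
          pd j (wordDeriv P.1 f * wordDeriv P.2 g) =
            pd j (wordDeriv P.1 f) * wordDeriv P.2 g + wordDeriv P.1 f * pd j (wordDeriv P.2 g) :=
        fun P => pd_mul j (hf.wordDeriv P.1).differentiable (hg.wordDeriv P.2).differentiable
      simp only [List.map_cons, List.map_append, List.map_map, List.sum_cons, List.sum_append,
        Function.comp_def, wordDeriv_cons, wordDeriv_nil, hprod, List.sum_map_add]
      abel

/-- The right-hand side of the commutator estimate, in terms of `derivNorm`. -/
def commutatorBound (k : ℕ) (f g : (Fin N → ℝ) → ℝ) : ℝ≥0∞ :=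
  (⨆ j : Fin N, eLpNorm (pd j f) ⊤ (boxMeasure N)) * derivNorm g (k - 1) 2 +
    eLpNorm g ⊤ (boxMeasure N) * derivNorm f k 2

lemma exists_eLpNorm_leibniz_term_le {k : ℕ} {L M : List (Fin N)} (hL : L ≠ [])
    (hLM : L.length + M.length ≤ k) :
    ∃ C : ℝ≥0, ∀ f g : (Fin N → ℝ) → ℝ, TorusSmooth f → TorusSmooth g →
      eLpNorm (wordDeriv L f * wordDeriv M g) 2 (boxMeasure N) ≤ C * commutatorBound k f g := by
  obtain ⟨L, j, rfl⟩ := (List.eq_nil_or_concat L).resolve_left hL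
  simp only [List.concat_eq_append, List.length_append, List.length_singleton] at hLM
  rcases Nat.eq_zero_or_pos (L.length + M.length) with h0 | h0
  · obtain rfl : L = [] := List.length_eq_zero_iff.1 (by omega)
    obtain rfl : M = [] := List.length_eq_zero_iff.1 (by omega)
    refine ⟨2 ^ (k - 1), fun f g hf hg => ?_⟩
    calc eLpNorm (pd j f * g) 2 (boxMeasure N)
        ≤ eLpNorm (pd j f) 2 (boxMeasure N) * eLpNorm g ⊤ (boxMeasure N) :=
          eLpNorm_mul_le_of_continuous (hf.pd j).continuous hg.continuous ⟨by simp⟩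
      _ ≤ (2 ^ (k - 1) * derivNorm f k 2) * eLpNorm g ⊤ (boxMeasure N) := by
          gcongr
          exact (le_derivNorm f (L := [j]) rfl 2).trans
            (derivNorm_le_of_le hf one_pos (by simpa using hLM))
      _ = 2 ^ (k - 1) * (eLpNorm g ⊤ (boxMeasure N) * derivNorm f k 2) := by ring
      _ ≤ _ := by
          push_cast
          gcongr
          exact le_add_self
  · set n := L.length + M.length with hn
    refine ⟨((2 * n : ℕ) : ℝ≥0) ^ n ^ 2 * 2 ^ (k - 1 - n), fun f g hf hg => ?_⟩
    rw [List.concat_eq_append, wordDeriv_append]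
    refine (eLpNorm_wordDeriv_mul_le (hf.pd j) hg h0 hn.symm).trans ?_
    have h1 : derivNorm g n 2 ≤ 2 ^ (k - 1 - n) * derivNorm g (k - 1) 2 :=
      derivNorm_le_of_le hg h0 (by omega)
    have h2 : derivNorm (pd j f) n 2 ≤ 2 ^ (k - 1 - n) * derivNorm f k 2 := by
      rw [show k - 1 - n = k - (n + 1) by omega]
      exact (derivNorm_pd_le f j n 2).trans (derivNorm_le_of_le hf (by omega) (by omega))
    have h3 := le_iSup (fun j : Fin N => eLpNorm (pd j f) ⊤ (boxMeasure N)) j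
    rw [ENNReal.coe_mul, mul_assoc]
    simp only [ENNReal.coe_pow, ENNReal.coe_natCast, ENNReal.coe_ofNat]
    gcongr
    refine (add_le_add (mul_le_mul' h3 h1) (mul_le_mul' le_rfl h2)).trans_eq ?_
    rw [commutatorBound]
    ring

lemma exists_eLpNorm_leibniz_sum_le {k : ℕ} {T : List (List (Fin N) × List (Fin N))}
    (hT : ∀ P ∈ T, P.1 ≠ [] ∧ P.1.length + P.2.length ≤ k) :
    ∃ C : ℝ≥0, ∀ f g : (Fin N → ℝ) → ℝ, TorusSmooth f → TorusSmooth g →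
      eLpNorm (T.map fun P => wordDeriv P.1 f * wordDeriv P.2 g).sum 2 (boxMeasure N) ≤
        C * commutatorBound k f g := by
  induction T with
  | nil => exact ⟨0, by simp⟩
  | cons P T ih =>
    rw [List.forall_mem_cons] at hT
    obtain ⟨C₁, h₁⟩ := exists_eLpNorm_leibniz_term_le hT.1.1 hT.1.2
    obtain ⟨C₂, h₂⟩ := ih hT.2
    refine ⟨C₁ + C₂, fun f g hf hg => ?_⟩
    have hd : Differentiable ℝ (T.map fun P => wordDeriv P.1 f * wordDeriv P.2 g).sum := by
      refine differentiable_list_sum ?_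
      simp only [List.mem_map]
      rintro h ⟨P, -, rfl⟩
      exact (hf.wordDeriv P.1).differentiable.mul (hg.wordDeriv P.2).differentiable
    rw [List.map_cons, List.sum_cons, ENNReal.coe_add, add_mul]
    exact (eLpNorm_add_le ((hf.wordDeriv _).continuous.mul
      (hg.wordDeriv _).continuous).aestronglyMeasurable hd.continuous.aestronglyMeasurable
      one_le_two).trans (add_le_add (h₁ f g hf hg) (h₂ f g hf hg))

lemma exists_eLpNorm_commutator_le (k : ℕ) {α : Fin N → ℕ} (hα : ∑ j, α j ≤ k) :
    ∃ C : ℝ≥0, ∀ f g : (Fin N → ℝ) → ℝ, TorusSmooth f → TorusSmooth g →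
      eLpNorm (fun x => Dalpha α (f * g) x - f x * Dalpha α g x) 2 (boxMeasure N) ≤
        C * commutatorBound k f g := by
  obtain ⟨T, hT, hsum⟩ := exists_wordDeriv_mul_eq (multiIndexWord α)
  rw [length_multiIndexWord] at hT
  obtain ⟨C, hC⟩ := exists_eLpNorm_leibniz_sum_le (k := k) (T := T)
    fun P hP => ⟨(hT P hP).1, (hT P hP).2.trans_le hα⟩
  refine ⟨C, fun f g hf hg => ?_⟩
  convert hC f g hf hg using 2
  funext x
  simp [Dalpha_eq_wordDeriv, hsum f g hf hg]

end Commutator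

/-- Klainerman–Majda commutator estimate on the torus:
`‖D^α(fg) − f D^α g‖_{L²} ≤ C (‖Df‖_{L^∞} ‖D^{k−1} g‖_{L²} + ‖g‖_{L^∞} ‖D^k f‖_{L²})`
for `|α| ≤ k`, with `C = C(N,k)`. -/
theorem stmt10 (N k : ℕ) :
    ∃ C : ℝ≥0, 0 < C ∧ ∀ f g : (Fin N → ℝ) → ℝ,
      ContDiff ℝ (⊤ : ℕ∞) f → ContDiff ℝ (⊤ : ℕ∞) g →
      (∀ x j, f (x + Pi.single j 1) = f x) →
      (∀ x j, g (x + Pi.single j 1) = g x) →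
      ∀ α : Fin N → ℕ, (∑ j, α j) ≤ k →
        eLpNorm (fun x => Dalpha α (f * g) x - f x * Dalpha α g x) 2
            (volume.restrict (unitBox N)) ≤
          C * ((⨆ j : Fin N, eLpNorm (pd j f) ⊤ (volume.restrict (unitBox N))) *
                (⨆ (β : Fin N → ℕ) (_ : (∑ j, β j) = k - 1),
                  eLpNorm (Dalpha β g) 2 (volume.restrict (unitBox N)))
              + eLpNorm g ⊤ (volume.restrict (unitBox N)) *
                (⨆ (β : Fin N → ℕ) (_ : (∑ j, β j) = k),
                  eLpNorm (Dalpha β f) 2 (volume.restrict (unitBox N)))) := by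
  have hex : ∀ α : Fin N → ℕ, ∃ C : ℝ≥0, (∑ j, α j) ≤ k →
      ∀ f g : (Fin N → ℝ) → ℝ, TorusSmooth f → TorusSmooth g →
        eLpNorm (fun x => Dalpha α (f * g) x - f x * Dalpha α g x) 2 (boxMeasure N) ≤
          C * commutatorBound k f g := by
    intro α
    by_cases hα : (∑ j, α j) ≤ k
    · obtain ⟨C, hC⟩ := exists_eLpNorm_commutator_le k hα
      exact ⟨C, fun _ => hC⟩
    · exact ⟨0, fun h => absurd h hα⟩
  choose C hC using hex
  refine ⟨1 + ∑ α ∈ Finset.Iic (fun _ : Fin N => k), C α, by positivity,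
    fun f g hf hg hfp hgp α hα => ?_⟩
  have hfT : TorusSmooth f := ⟨hf, hfp⟩
  have hgT : TorusSmooth g := ⟨hg, hgp⟩
  have hmem : α ∈ Finset.Iic (fun _ : Fin N => k) :=
    Finset.mem_Iic.2 fun j =>
      (Finset.single_le_sum (fun _ _ => Nat.zero_le _) (Finset.mem_univ j)).trans hα
  refine (hC α hα f g hfT hgT).trans (mul_le_mul' ?_ ?_)
  · refine ENNReal.coe_le_coe.2 (le_add_left ?_)
    exact Finset.single_le_sum (f := C) (fun _ _ => zero_le) hmem
  · exact add_le_add (mul_le_mul' le_rfl (derivNorm_le_iSup_Dalpha hgT _ _))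
      (mul_le_mul' le_rfl (derivNorm_le_iSup_Dalpha hfT _ _))
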